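/- Let X be as in Assumption (A): P(|X| ≥ r, X/|X| ∈ B) = ∫_B (A+ε(r,θ))/r^α ν(dθ) with sup_θ|ε(r,θ)| ≤ K(1 ∧ r^{-γ}), and fix α̃ ∈ (α,2). Define the tilted measure μ̃(E) = (1-q)^{-1} E[(|X|^{α-α̃} ∧ 1)·1_E(X)] where q = 1 - E[|X|^{α-α̃} ∧ 1]. Then for r ≥ 1 and Borel B ⊆ S^{d-1}, μ̃({x : |x| ≥ r, x/|x| ∈ B}) = (1-q)^{-1} ∫_B r^{-α̃} [Aα/α̃ + ε(r,θ) - (α̃-α) r^{α̃} ∫_r^∞ ε(s,θ) s^{-α̃-1} ds] ν(dθ). -/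

import Mathlib

open MeasureTheory Set

noncomputable section

/-- Layer-cake representation of a negative power, truncated below at `r`. -/
theorem integral_Ioi_rpow_mul_indicator_Iic {r x δ : ℝ} (hr : 0 < r) (hx : r ≤ x) (hδ : 0 < δ) :
    ∫ s in Ioi r, s ^ (-δ - 1) * (Iic x).indicator 1 s = (r ^ (-δ) - x ^ (-δ)) / δ := by
  have h1 : ∀ s : ℝ, s ^ (-δ - 1) * (Iic x).indicator 1 s
      = (Iic x).indicator (fun s => s ^ (-δ - 1)) s := by
    intro s
    by_cases h : s ∈ Iic x <;> simp [h]
  simp_rw [h1]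
  rw [setIntegral_indicator measurableSet_Iic, Ioi_inter_Iic,
    ← intervalIntegral.integral_of_le hx, integral_rpow]
  · rw [sub_add_cancel, div_neg, ← neg_div, neg_sub]
  · refine Or.inr ⟨by linarith, ?_⟩
    rw [uIcc_of_le hx]
    exact fun h => absurd h.1 (not_le.mpr hr)

/-- If a finite measure, tested on measurable sets, is the truncation at zero of the set function
`B ↦ ∫ θ in B, f θ ∂ν`, and does not vanish, then no truncation takes place. -/
theorem setIntegral_nonneg_of_measure_eq_ofReal {Θ : Type*} [MeasurableSpace Θ] {ν m : Measure Θ}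
    {f : Θ → ℝ} (hf : Integrable f ν)
    (hm : ∀ B, MeasurableSet B → m B = ENNReal.ofReal (∫ θ in B, f θ ∂ν))
    (hpos : m univ ≠ 0) {B : Set Θ} (hB : MeasurableSet B) : 0 ≤ ∫ θ in B, f θ ∂ν := by
  by_contra! hneg
  have hB0 : m B = 0 := by rw [hm B hB, ENNReal.ofReal_of_nonpos hneg.le]
  have hadd : m Bᶜ = m univ := by rw [← measure_add_measure_compl hB, hB0, zero_add]
  have hint := integral_add_compl hB hf
  have hu := hm univ .univ
  rw [Measure.restrict_univ] at hu
  have hupos : 0 < ∫ θ, f θ ∂ν := by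
    by_contra! h
    exact hpos (by rw [hu, ENNReal.ofReal_of_nonpos h])
  rw [hm _ hB.compl, hu, ENNReal.ofReal_eq_ofReal_iff (by linarith) hupos.le] at hadd
  linarith

/-- The event that a random vector has norm at least `r` and direction in `B` is measurable. -/
theorem measurableSet_le_norm_and_direction_mem {d : ℕ} {Ω : Type*} [MeasurableSpace Ω]
    {X : Ω → EuclideanSpace ℝ (Fin d)} (hX : Measurable X)
    {B : Set (Metric.sphere (0 : EuclideanSpace ℝ (Fin d)) 1)} (hB : MeasurableSet B) (r : ℝ) :
    MeasurableSet {ω | r ≤ ‖X ω‖ ∧ (‖X ω‖⁻¹ • X ω) ∈ Subtype.val '' B} := by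
  have hB' : MeasurableSet (Subtype.val '' B) :=
    Metric.isClosed_sphere.measurableSet.subtype_image hB
  exact (measurableSet_le measurable_const hX.norm).inter
    ((hX.norm.inv.smul hX) hB')

/-- The tail formula holds without truncation at zero. -/
theorem measureReal_le_norm_and_direction_mem {d : ℕ} {Ω : Type*} [MeasurableSpace Ω]
    {P : Measure Ω} [IsProbabilityMeasure P]
    {X : Ω → EuclideanSpace ℝ (Fin d)} (hX : Measurable X)
    {α A K γ : ℝ} (hA : 0 < A) (hγ : 0 < γ)
    {ν : Measure (Metric.sphere (0 : EuclideanSpace ℝ (Fin d)) 1)} [IsProbabilityMeasure ν]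
    {ε : ℝ → Metric.sphere (0 : EuclideanSpace ℝ (Fin d)) 1 → ℝ}
    (hεm : Measurable (Function.uncurry ε))
    (hε : ∀ r > (0 : ℝ), ∀ θ, |ε r θ| ≤ K * min 1 (r ^ (-γ)))
    (htail : ∀ r > (0 : ℝ), ∀ B : Set (Metric.sphere (0 : EuclideanSpace ℝ (Fin d)) 1),
      MeasurableSet B →
      P {ω | r ≤ ‖X ω‖ ∧ (‖X ω‖⁻¹ • X ω) ∈ Subtype.val '' B} =
        ENNReal.ofReal (∫ θ in B, (A + ε r θ) / r ^ α ∂ν))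
    {r : ℝ} (hr : 0 < r) {B : Set (Metric.sphere (0 : EuclideanSpace ℝ (Fin d)) 1)}
    (hB : MeasurableSet B) :
    P.real {ω | r ≤ ‖X ω‖ ∧ (‖X ω‖⁻¹ • X ω) ∈ Subtype.val '' B} =
      ∫ θ in B, (A + ε r θ) / r ^ α ∂ν := by
  have hmeas : ∀ s, Measurable (ε s) := fun s => hεm.comp measurable_prodMk_left
  have hint : ∀ s > 0, Integrable (fun θ => (A + ε s θ) / s ^ α) ν := fun s hs =>
    ((integrable_const A).add (Integrable.of_bound (hmeas s).aestronglyMeasurable _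
      (ae_of_all _ (hε s hs)))).div_const _
  have hpos : P {ω | r ≤ ‖X ω‖ ∧ (‖X ω‖⁻¹ • X ω) ∈
      Subtype.val '' (univ : Set (Metric.sphere (0 : EuclideanSpace ℝ (Fin d)) 1))} ≠ 0 := by
    have hlim : Filter.Tendsto (fun s : ℝ => K * s ^ (-γ)) Filter.atTop (nhds 0) := by
      simpa using (tendsto_rpow_neg_atTop hγ).const_mul K
    obtain ⟨s, hsA, hrs, hs1⟩ := ((hlim.eventually_lt_const hA).and
      ((Filter.eventually_ge_atTop r).and (Filter.eventually_ge_atTop 1))).exists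
    have hs0 : 0 < s := by linarith
    have hεs : ∀ θ, 0 < (A + ε s θ) / s ^ α := by
      intro θ
      have h := hε s hs0 θ
      rw [min_eq_right (Real.rpow_le_one_of_one_le_of_nonpos hs1 (by linarith))] at h
      have := neg_abs_le (ε s θ)
      exact div_pos (by linarith) (Real.rpow_pos_of_pos hs0 _)
    have hspos : P {ω | s ≤ ‖X ω‖ ∧ (‖X ω‖⁻¹ • X ω) ∈
        Subtype.val '' (univ : Set (Metric.sphere (0 : EuclideanSpace ℝ (Fin d)) 1))} ≠ 0 := by
      rw [htail s hs0 _ .univ, Measure.restrict_univ]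
      refine (ENNReal.ofReal_pos.mpr ?_).ne'
      rw [integral_pos_iff_support_of_nonneg (fun θ => (hεs θ).le) (hint s hs0),
        Function.support_eq_univ (fun θ => (hεs θ).ne')]
      simp
    refine fun h => hspos (measure_mono_null ?_ h)
    exact fun ω hω => ⟨hrs.trans hω.1, hω.2⟩
  have hdir : Measurable fun ω => ‖X ω‖⁻¹ • X ω := hX.norm.inv.smul hX
  have hemb : MeasurableEmbedding
      (Subtype.val : Metric.sphere (0 : EuclideanSpace ℝ (Fin d)) 1 → _) :=
    MeasurableEmbedding.subtype_coe Metric.isClosed_sphere.measurableSet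
  let m := ((P.restrict {ω | r ≤ ‖X ω‖}).map fun ω => ‖X ω‖⁻¹ • X ω).comap
    (Subtype.val : Metric.sphere (0 : EuclideanSpace ℝ (Fin d)) 1 → _)
  have hm : ∀ C : Set (Metric.sphere (0 : EuclideanSpace ℝ (Fin d)) 1), MeasurableSet C →
      m C = P {ω | r ≤ ‖X ω‖ ∧ (‖X ω‖⁻¹ • X ω) ∈ Subtype.val '' C} := by
    intro C hC
    have hC' := hemb.measurableSet_image.mpr hC
    rw [hemb.comap_apply, Measure.map_apply hdir hC', Measure.restrict_apply (hdir hC'),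
      inter_comm]
    rfl
  have h0 := setIntegral_nonneg_of_measure_eq_ofReal (m := m) (hint r hr)
    (fun C hC => (hm C hC).trans (htail r hr C hC)) (by rwa [hm _ .univ]) hB
  rw [measureReal_def, htail r hr B hB, ENNReal.toReal_ofReal h0]

theorem stmt_5 {d : ℕ} {Ω : Type*} [MeasurableSpace Ω]
    (P : Measure Ω) [IsProbabilityMeasure P]
    (X : Ω → EuclideanSpace ℝ (Fin d)) (hX : Measurable X)
    (α αt A K γ : ℝ) (hα : α ∈ Set.Ioo (0 : ℝ) 2) (hαt : αt ∈ Set.Ioo α 2)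
    (hA : 0 < A) (hK : 0 < K) (hγ : 0 < γ)
    (ν : Measure (Metric.sphere (0 : EuclideanSpace ℝ (Fin d)) 1)) [IsProbabilityMeasure ν]
    (ε : ℝ → Metric.sphere (0 : EuclideanSpace ℝ (Fin d)) 1 → ℝ)
    (hεm : Measurable (Function.uncurry ε))
    (hε : ∀ r > (0 : ℝ), ∀ θ, |ε r θ| ≤ K * min 1 (r ^ (-γ)))
    (htail : ∀ r > (0 : ℝ), ∀ B : Set (Metric.sphere (0 : EuclideanSpace ℝ (Fin d)) 1),
      MeasurableSet B →
      P {ω | r ≤ ‖X ω‖ ∧ (‖X ω‖⁻¹ • X ω) ∈ Subtype.val '' B} =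
        ENNReal.ofReal (∫ θ in B, (A + ε r θ) / r ^ α ∂ν))
    (q : ℝ) (hq : q = 1 - ∫ ω, min (‖X ω‖ ^ (α - αt)) 1 ∂P) :
    ∀ r ≥ (1 : ℝ), ∀ B : Set (Metric.sphere (0 : EuclideanSpace ℝ (Fin d)) 1),
      MeasurableSet B →
      (1 - q)⁻¹ *
        ∫ ω, min (‖X ω‖ ^ (α - αt)) 1 *
          Set.indicator {x : EuclideanSpace ℝ (Fin d) |
            r ≤ ‖x‖ ∧ (‖x‖⁻¹ • x) ∈ Subtype.val '' B} 1 (X ω) ∂P =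
      (1 - q)⁻¹ *
        ∫ θ in B, r ^ (-αt) *
          (A * α / αt + ε r θ -
            (αt - α) * r ^ αt * ∫ s in Set.Ioi r, ε s θ / s ^ (αt + 1)) ∂ν := by
  intro r hr B hB
  congr 1
  obtain ⟨hα0, -⟩ := hα
  obtain ⟨hδ', -⟩ := hαt
  have hr0 : 0 < r := by linarith
  have hαt0 : 0 < αt := by linarith
  obtain ⟨δ, hδdef⟩ : ∃ δ, δ = αt - α := ⟨_, rfl⟩
  have hδ : 0 < δ := by linarith
  have hαδ : α - αt = -δ := by linarith
  rw [hαδ, ← hδdef]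
  let E : ℝ → Set Ω := fun s => {ω | s ≤ ‖X ω‖ ∧ (‖X ω‖⁻¹ • X ω) ∈ Subtype.val '' B}
  have hE : ∀ s, MeasurableSet (E s) := fun s => measurableSet_le_norm_and_direction_mem hX hB s
  have hPE : ∀ s > 0, P.real (E s) = ∫ θ in B, (A + ε s θ) / s ^ α ∂ν := fun s hs =>
    measureReal_le_norm_and_direction_mem hX hA hγ hεm hε htail hs hB
  have hpow : IntegrableOn (fun s : ℝ => s ^ (-δ - 1)) (Ioi r) :=
    integrableOn_Ioi_rpow_of_lt (by linarith) hr0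
  have hpowt : IntegrableOn (fun s : ℝ => s ^ (-αt - 1)) (Ioi r) :=
    integrableOn_Ioi_rpow_of_lt (by linarith) hr0
  have hpt : ∀ ω, min (‖X ω‖ ^ (-δ)) 1 * Set.indicator {x : EuclideanSpace ℝ (Fin d) |
      r ≤ ‖x‖ ∧ (‖x‖⁻¹ • x) ∈ Subtype.val '' B} 1 (X ω) =
      r ^ (-δ) * (E r).indicator 1 ω -
        δ * ∫ s in Ioi r, s ^ (-δ - 1) * (E s).indicator 1 ω := by
    intro ω
    by_cases hω : ω ∈ E r
    · have h1 : X ω ∈ {x : EuclideanSpace ℝ (Fin d) |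
        r ≤ ‖x‖ ∧ (‖x‖⁻¹ • x) ∈ Subtype.val '' B} := hω
      have h2 : ∀ s, (E s).indicator (1 : Ω → ℝ) ω = (Iic ‖X ω‖).indicator 1 s := by
        intro s
        by_cases hs : s ≤ ‖X ω‖
        · rw [indicator_of_mem (show ω ∈ E s from ⟨hs, hω.2⟩),
            indicator_of_mem (show s ∈ Iic ‖X ω‖ from hs)]
          rfl
        · rw [indicator_of_notMem (show ω ∉ E s from fun h => hs h.1),
            indicator_of_notMem (show s ∉ Iic ‖X ω‖ from hs)]
      simp_rw [h2]
      rw [integral_Ioi_rpow_mul_indicator_Iic hr0 hω.1 hδ, indicator_of_mem h1,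
        indicator_of_mem (show r ∈ Iic ‖X ω‖ from hω.1), min_eq_left (Real.rpow_le_one_of_one_le_of_nonpos
          (hr.trans hω.1) (by linarith))]
      simp only [Pi.one_apply]
      field_simp
      ring
    · have h1 : X ω ∉ {x : EuclideanSpace ℝ (Fin d) |
        r ≤ ‖x‖ ∧ (‖x‖⁻¹ • x) ∈ Subtype.val '' B} := hω
      rw [indicator_of_notMem h1, indicator_of_notMem hω,
        setIntegral_congr_fun (g := fun _ => (0 : ℝ)) measurableSet_Ioi]
      · simp
      · intro s hs
        have : ω ∉ E s := fun h => hω ⟨(le_of_lt hs).trans h.1, h.2⟩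
        simp [this]
  have hF : Integrable (Function.uncurry fun ω s => s ^ (-δ - 1) * (E s).indicator (1 : Ω → ℝ) ω)
      (P.prod (volume.restrict (Ioi r))) := by
    have hS : MeasurableSet {p : Ω × ℝ | p.1 ∈ E p.2} :=
      (measurableSet_le measurable_snd (hX.norm.comp measurable_fst)).inter
        (measurable_fst (((hX.norm.inv.smul hX))
          (Metric.isClosed_sphere.measurableSet.subtype_image hB)))
    have := (hpow.integrable.comp_snd P).indicator hS
    refine this.congr (ae_of_all _ fun p => ?_)
    by_cases hp : p.1 ∈ E p.2
    · rw [indicator_of_mem (show p ∈ {p : Ω × ℝ | p.1 ∈ E p.2} from hp)]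
      simp [Function.uncurry, hp]
    · rw [indicator_of_notMem (show p ∉ {p : Ω × ℝ | p.1 ∈ E p.2} from hp)]
      simp [Function.uncurry, hp]
  have hbound : ∀ s > 0, ∀ θ, |ε s θ| ≤ K := fun s hs θ =>
    (hε s hs θ).trans (mul_le_of_le_one_right hK.le (min_le_left _ _))
  have hG : Integrable (Function.uncurry fun s θ => s ^ (-αt - 1) * (A + ε s θ))
      ((volume.restrict (Ioi r)).prod (ν.restrict B)) := by
    refine (hpowt.integrable.comp_fst (ν.restrict B)).mul_bdd (c := A + K)
      (hεm.const_add A).aestronglyMeasurable ?_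
    have hae : ∀ᵐ s ∂(volume.restrict (Ioi r)), s ∈ Ioi r := ae_restrict_mem measurableSet_Ioi
    filter_upwards [Measure.quasiMeasurePreserving_fst.ae hae] with p hp
    have hp0 : 0 < p.1 := hr0.trans hp
    refine (abs_add_le _ _).trans ?_
    rw [abs_of_pos hA]
    exact add_le_add_right (hbound p.1 hp0 p.2) A
  have hεr : Integrable (ε r) (ν.restrict B) :=
    Integrable.of_bound (hεm.comp measurable_prodMk_left).aestronglyMeasurable K
      (ae_of_all _ (hbound r hr0))
  have hind : ∀ s, ∫ ω, (E s).indicator (1 : Ω → ℝ) ω ∂P = P.real (E s) := fun s =>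
    integral_indicator_one (hE s)
  have hleft : ∫ ω, (r ^ (-δ) * (E r).indicator 1 ω -
        δ * ∫ s in Ioi r, s ^ (-δ - 1) * (E s).indicator 1 ω) ∂P =
      r ^ (-δ) * P.real (E r) - δ * ∫ s in Ioi r, s ^ (-δ - 1) * P.real (E s) := by
    have h1 : Integrable (fun ω => r ^ (-δ) * (E r).indicator (1 : Ω → ℝ) ω) P :=
      ((integrable_const (1 : ℝ)).indicator (hE r)).const_mul _
    have h2 : Integrable (fun ω => δ * ∫ s in Ioi r,
        s ^ (-δ - 1) * (E s).indicator (1 : Ω → ℝ) ω) P := hF.integral_prod_left.const_mul δ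
    rw [integral_sub h1 h2, integral_const_mul, integral_const_mul, hind,
      integral_integral_swap hF]
    simp_rw [integral_const_mul, hind]
  have htailint : ∫ s in Ioi r, s ^ (-δ - 1) * P.real (E s) =
      ∫ θ in B, (∫ s in Ioi r, s ^ (-αt - 1) * (A + ε s θ)) ∂ν := by
    rw [← integral_integral_swap hG]
    refine setIntegral_congr_fun measurableSet_Ioi fun s hs => ?_
    have hs0 : 0 < s := hr0.trans hs
    simp only [hPE s hs0]
    rw [← integral_const_mul]
    congr 1 with θ
    rw [show -αt - 1 = -δ - 1 - α by linarith, Real.rpow_sub hs0 (-δ - 1) α]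
    ring
  have hinner : ∀ θ, ∫ s in Ioi r, s ^ (-αt - 1) * (A + ε s θ) =
      A * r ^ (-αt) / αt + ∫ s in Ioi r, ε s θ / s ^ (αt + 1) := by
    intro θ
    have h1 : IntegrableOn (fun s => s ^ (-αt - 1) * ε s θ) (Ioi r) :=
      hpowt.integrable.mul_bdd (c := K)
        (hεm.comp measurable_prodMk_right).aestronglyMeasurable
        ((ae_restrict_mem measurableSet_Ioi).mono fun s hs => hbound s (hr0.trans hs) θ)
    simp_rw [mul_add]
    rw [integral_add (hpowt.integrable.mul_const A) h1, integral_mul_const,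
      integral_Ioi_rpow_of_lt (by linarith) hr0, sub_add_cancel, neg_div_neg_eq]
    congr 1
    · ring
    · refine setIntegral_congr_fun measurableSet_Ioi fun s hs => ?_
      have hs0 : 0 < s := hr0.trans hs
      rw [show -αt - 1 = -(αt + 1) by ring, Real.rpow_neg hs0.le]
      ring
  simp_rw [hpt]
  rw [hleft, htailint, hPE r hr0, ← integral_const_mul, ← integral_const_mul,
    ← integral_sub]
  · congr 1 with θ
    rw [hinner θ, show -αt = -δ - α by linarith, Real.rpow_sub hr0 (-δ) α,
      show αt = δ + α by linarith, Real.rpow_add hr0, Real.rpow_neg hr0.le]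
    have h1 := (Real.rpow_pos_of_pos hr0 α).ne'
    have h2 := (Real.rpow_pos_of_pos hr0 δ).ne'
    have h3 : δ + α ≠ 0 := by linarith
    field_simp
    ring
  · exact (((integrable_const A).add hεr).div_const _).const_mul _
  · exact hG.integral_prod_right.const_mul δ
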